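/- arXiv:math/0503476 — 2 statements merged into one kernel-verified Lean document; each statement's English description precedes it below -/
import Mathlib

section
/- Let φ : ℝⁿ → ℝ be a C¹ strictly convex function with φ(x)/‖x‖ → ∞ as ‖x‖ → ∞, and suppose ∫ e^{-φ(x)} dx = 1; let μ_φ be the probability measure with density e^{-φ} with respect to Lebesgue measure. Then for every sufficiently smooth function g : ℝⁿ → ℝ (such that all integrals below exist), Ent_{μ_φ}(e^g) ≤ ∫ [x·∇g(x) − φ*(∇φ(x)) + φ*(∇φ(x) − ∇g(x))] e^{g(x)} dμ_φ(x), where φ*(y) = sup_{z ∈ ℝⁿ} (y·z − φ(z)) is the Legendre transform and Ent_μ(f) = ∫ f log(f/∫f dμ) dμ. -/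
open MeasureTheory Real Filter Bornology
open scoped RealInnerProductSpace

/-- The Legendre (Fenchel) transform of `φ`. -/
noncomputable def legendre {n : ℕ} (φ : EuclideanSpace ℝ (Fin n) → ℝ)
    (y : EuclideanSpace ℝ (Fin n)) : ℝ :=
  ⨆ z, ⟪y, z⟫ - φ z

/-- The entropy of `f` with respect to `μ`. -/
noncomputable def Ent {n : ℕ} (μ : Measure (EuclideanSpace ℝ (Fin n)))
    (f : EuclideanSpace ℝ (Fin n) → ℝ) : ℝ :=
  ∫ x, f x * Real.log (f x / ∫ y, f y ∂μ) ∂μ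

open scoped Pointwise in
/-- The one-dimensional Brunn–Minkowski inequality for compact sets. -/
theorem volume_add_le_volume_add_of_isCompact {A B : Set ℝ} (hA : IsCompact A) (hB : IsCompact B)
    (hA' : A.Nonempty) (hB' : B.Nonempty) : volume A + volume B ≤ volume (A + B) := by
  have ha := hA.sSup_mem hA'
  have hb := hB.sInf_mem hB'
  have hdisj : AEDisjoint volume (sInf B +ᵥ A) (sSup A +ᵥ B) := by
    refine measure_mono_null (t := {sSup A + sInf B}) ?_ (by simp)
    rintro _ ⟨⟨x, hx, rfl⟩, y, hy, hxy⟩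
    have h1 := le_csSup hA.bddAbove hx
    have h2 := csInf_le hB.bddBelow hy
    simp only [vadd_eq_add, Set.mem_singleton_iff] at *
    linarith
  calc volume A + volume B = volume (sInf B +ᵥ A) + volume (sSup A +ᵥ B) := by
        rw [measure_vadd, measure_vadd]
    _ = volume ((sInf B +ᵥ A) ∪ (sSup A +ᵥ B)) :=
        (measure_union₀ (hB.vadd _).measurableSet.nullMeasurableSet hdisj).symm
    _ ≤ volume (A + B) := by
        refine measure_mono (Set.union_subset ?_ ?_)
        · rintro _ ⟨x, hx, rfl⟩
          exact ⟨x, hx, _, hb, add_comm _ _⟩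
        · rintro _ ⟨y, hy, rfl⟩
          exact ⟨_, ha, y, hy, rfl⟩

/-- The arithmetic form of the one-dimensional Prékopa–Leindler inequality, for functions whose
maximum on the interval is `1`. -/
theorem lintegral_add_le_of_forall_rpow_mul_rpow_le {R s : ℝ} (hs0 : 0 < s) (hs1 : s < 1)
    {f g k : ℝ → ℝ} (hf : Continuous f) (hg : Continuous g) (hk : Continuous k)
    (hf0 : ∀ x, 0 < f x) (hg0 : ∀ x, 0 < g x) (hk0 : ∀ x, 0 < k x)
    (hf1 : IsGreatest (f '' Set.Icc (-R) R) 1) (hg1 : IsGreatest (g '' Set.Icc (-R) R) 1)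
    (h : ∀ x ∈ Set.Icc (-R) R, ∀ y ∈ Set.Icc (-R) R,
      f x ^ (1 - s) * g y ^ s ≤ k ((1 - s) * x + s * y)) :
    ENNReal.ofReal (1 - s) * (∫⁻ x in Set.Icc (-R) R, ENNReal.ofReal (f x)) +
      ENNReal.ofReal s * (∫⁻ x in Set.Icc (-R) R, ENNReal.ofReal (g x)) ≤
      ∫⁻ x in Set.Icc (-R) R, ENNReal.ofReal (k x) := by
  rw [lintegral_eq_lintegral_meas_le _ (.of_forall fun x => (hf0 x).le) hf.aemeasurable,
    lintegral_eq_lintegral_meas_le _ (.of_forall fun x => (hg0 x).le) hg.aemeasurable,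
    lintegral_eq_lintegral_meas_le _ (.of_forall fun x => (hk0 x).le) hk.aemeasurable,
    ← lintegral_const_mul' _ _ ENNReal.ofReal_ne_top,
    ← lintegral_const_mul' _ _ ENNReal.ofReal_ne_top]
  refine (le_lintegral_add _ _).trans (setLIntegral_mono' measurableSet_Ioi fun t ht => ?_)
  have hclosed {u : ℝ → ℝ} (hu : Continuous u) : IsClosed {x | t ≤ u x} :=
    isClosed_le continuous_const hu
  rw [Measure.restrict_apply (hclosed hf).measurableSet,
    Measure.restrict_apply (hclosed hg).measurableSet,
    Measure.restrict_apply (hclosed hk).measurableSet]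
  set A := {x | t ≤ f x} ∩ Set.Icc (-R) R
  set B := {x | t ≤ g x} ∩ Set.Icc (-R) R
  rcases lt_or_ge 1 t with ht1 | ht1
  · have hA : A = ∅ := Set.eq_empty_of_forall_notMem fun x hx =>
      (ht1.trans_le hx.1).not_ge (hf1.2 ⟨x, hx.2, rfl⟩)
    have hB : B = ∅ := Set.eq_empty_of_forall_notMem fun x hx =>
      (ht1.trans_le hx.1).not_ge (hg1.2 ⟨x, hx.2, rfl⟩)
    simp [hA, hB]
  · have hA : IsCompact A := isCompact_Icc.inter_left (hclosed hf)
    have hB : IsCompact B := isCompact_Icc.inter_left (hclosed hg)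
    obtain ⟨x, hx, hfx⟩ := hf1.1
    obtain ⟨y, hy, hgy⟩ := hg1.1
    have hA' : A.Nonempty := ⟨x, by simpa [hfx] using ht1, hx⟩
    have hB' : B.Nonempty := ⟨y, by simpa [hgy] using ht1, hy⟩
    open scoped Pointwise in
    calc ENNReal.ofReal (1 - s) * volume A + ENNReal.ofReal s * volume B
        = volume ((1 - s) • A) + volume (s • B) := by
          simp [Measure.addHaar_smul, abs_of_pos hs0, abs_of_pos (sub_pos.2 hs1)]
      _ ≤ volume ((1 - s) • A + s • B) :=
          volume_add_le_volume_add_of_isCompact (hA.smul _) (hB.smul _) hA'.smul_set hB'.smul_set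
      _ ≤ _ := by
          refine measure_mono ?_
          rintro _ ⟨_, ⟨x, hx, rfl⟩, _, ⟨y, hy, rfl⟩, rfl⟩
          refine ⟨?_, ?_⟩
          · refine le_trans ?_ (h x hx.2 y hy.2)
            calc t = t ^ (1 - s) * t ^ s := by
                  rw [← rpow_add ht, sub_add_cancel, rpow_one]
              _ ≤ _ := mul_le_mul (rpow_le_rpow ht.le hx.1 (sub_pos.2 hs1).le)
                (rpow_le_rpow ht.le hy.1 hs0.le) (rpow_nonneg ht.le _)
                (rpow_nonneg (hf0 x).le _)
          · exact convex_Icc (-R) R hx.2 hy.2 (sub_pos.2 hs1).le hs0.le (by ring)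

/-- The one-dimensional Prékopa–Leindler inequality for continuous functions on an interval. -/
theorem prekopa_leindler_Icc {R s : ℝ} (hR : 0 < R) (hs0 : 0 < s) (hs1 : s < 1)
    {f g k : ℝ → ℝ} (hf : Continuous f) (hg : Continuous g) (hk : Continuous k)
    (hf0 : ∀ x, 0 < f x) (hg0 : ∀ x, 0 < g x) (hk0 : ∀ x, 0 < k x)
    (h : ∀ x ∈ Set.Icc (-R) R, ∀ y ∈ Set.Icc (-R) R,
      f x ^ (1 - s) * g y ^ s ≤ k ((1 - s) * x + s * y)) :
    (∫ x in Set.Icc (-R) R, f x) ^ (1 - s) * (∫ x in Set.Icc (-R) R, g x) ^ s ≤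
      ∫ x in Set.Icc (-R) R, k x := by
  have hne : (Set.Icc (-R) R).Nonempty := Set.nonempty_Icc.2 (by linarith)
  obtain ⟨x₀, hx₀, hx₀'⟩ := isCompact_Icc.exists_isMaxOn hne hf.continuousOn
  obtain ⟨y₀, hy₀, hy₀'⟩ := isCompact_Icc.exists_isMaxOn hne hg.continuousOn
  set a := f x₀
  set b := g y₀
  have ha : 0 < a := hf0 _
  have hb : 0 < b := hg0 _
  have hs1' := sub_pos.2 hs1
  set c := a ^ (1 - s) * b ^ s
  have hc : 0 < c := by positivity
  have key := lintegral_add_le_of_forall_rpow_mul_rpow_le (R := R) hs0 hs1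
    (hf.div_const a) (hg.div_const b) (hk.div_const c)
    (fun x => div_pos (hf0 x) ha) (fun x => div_pos (hg0 x) hb) (fun x => div_pos (hk0 x) hc)
    ⟨⟨x₀, hx₀, div_self ha.ne'⟩, by
      rintro _ ⟨x, hx, rfl⟩; exact (div_le_one ha).2 (hx₀' hx)⟩
    ⟨⟨y₀, hy₀, div_self hb.ne'⟩, by
      rintro _ ⟨x, hx, rfl⟩; exact (div_le_one hb).2 (hy₀' hx)⟩
    (fun x hx y hy => by
      rw [div_rpow (hf0 x).le ha.le, div_rpow (hg0 y).le hb.le, div_mul_div_comm]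
      exact div_le_div_of_nonneg_right (h x hx y hy) hc.le)
  have hint {u : ℝ → ℝ} (hu : Continuous u) : IntegrableOn u (Set.Icc (-R) R) :=
    hu.continuousOn.integrableOn_compact isCompact_Icc
  have hpos {u : ℝ → ℝ} (hu0 : ∀ x, 0 < u x) : 0 ≤ ∫ x in Set.Icc (-R) R, u x :=
    integral_nonneg fun x => (hu0 x).le
  have hconv {u : ℝ → ℝ} {d : ℝ} (hd : 0 < d) (hu : Continuous u) (hu0 : ∀ x, 0 < u x) :
      ∫⁻ x in Set.Icc (-R) R, ENNReal.ofReal (u x / d) =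
        ENNReal.ofReal ((∫ x in Set.Icc (-R) R, u x) / d) := by
    rw [← integral_div, ofReal_integral_eq_lintegral_ofReal ((hint hu).div_const d)
      (.of_forall fun x => (div_pos (hu0 x) hd).le)]
  rw [hconv ha hf hf0, hconv hb hg hg0, hconv hc hk hk0,
    ← ENNReal.ofReal_mul hs1'.le, ← ENNReal.ofReal_mul hs0.le,
    ← ENNReal.ofReal_add (mul_nonneg hs1'.le (div_nonneg (hpos hf0) ha.le))
      (mul_nonneg hs0.le (div_nonneg (hpos hg0) hb.le)),
    ENNReal.ofReal_le_ofReal_iff (div_nonneg (hpos hk0) hc.le)] at key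
  have := (geom_mean_le_arith_mean2_weighted hs1'.le hs0.le (div_nonneg (hpos hf0) ha.le)
    (div_nonneg (hpos hg0) hb.le) (by ring)).trans key
  rwa [div_rpow (hpos hf0) ha.le, div_rpow (hpos hg0) hb.le, div_mul_div_comm,
    div_le_div_iff_of_pos_right hc] at this

theorem integral_cube_succ {n : ℕ} {R : ℝ} {f : (Fin (n + 1) → ℝ) → ℝ} (hf : Continuous f) :
    ∫ x in Set.Icc (fun _ => -R) (fun _ => R), f x =
      ∫ t in Set.Icc (-R) R, ∫ x in Set.Icc (fun _ : Fin n => -R) (fun _ => R),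
        f (Fin.cons t x) := by
  have hmp := (volume_preserving_piFinSuccAbove (fun _ : Fin (n + 1) => ℝ) 0).symm
  have hpre : (MeasurableEquiv.piFinSuccAbove (fun _ : Fin (n + 1) => ℝ) 0).symm ⁻¹'
      Set.Icc (fun _ => -R) (fun _ => R) =
      Set.Icc (-R) R ×ˢ Set.Icc (fun _ : Fin n => -R) (fun _ => R) := by
    ext ⟨t, x⟩
    simp [MeasurableEquiv.piFinSuccAbove_symm_apply, Fin.insertNthEquiv, Pi.le_def,
      Fin.forall_fin_succ]
  rw [← hmp.setIntegral_preimage_emb (MeasurableEquiv.measurableEmbedding _), hpre,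
    Measure.volume_eq_prod, setIntegral_prod]
  · simp [MeasurableEquiv.piFinSuccAbove_symm_apply, Fin.insertNthEquiv]
  · refine ContinuousOn.integrableOn_compact (isCompact_Icc.prod isCompact_Icc) ?_
    refine (hf.comp ?_).continuousOn
    simp only [MeasurableEquiv.piFinSuccAbove_symm_apply, Fin.insertNthEquiv]
    simp
    fun_prop

theorem volume_cube_pos {n : ℕ} {R : ℝ} (hR : 0 < R) :
    0 < volume (Set.Icc (fun _ : Fin n => -R) (fun _ => R)) := by
  rw [Real.volume_Icc_pi]
  simp [hR, pos_iff_ne_zero]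

theorem integral_cube_pos {n : ℕ} {R : ℝ} (hR : 0 < R) {f : (Fin n → ℝ) → ℝ}
    (hf : Continuous f) (hf0 : ∀ x, 0 < f x) :
    0 < ∫ x in Set.Icc (fun _ => -R) (fun _ => R), f x := by
  rw [setIntegral_pos_iff_support_of_nonneg_ae (.of_forall fun x => (hf0 x).le)
    (hf.continuousOn.integrableOn_compact isCompact_Icc)]
  rw [show Function.support f = Set.univ from
    Set.eq_univ_of_forall fun x => (hf0 x).ne', Set.univ_inter]
  exact volume_cube_pos hR

/-- The Prékopa–Leindler inequality for continuous functions on a cube. -/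
theorem prekopa_leindler_cube {R s : ℝ} (hR : 0 < R) (hs0 : 0 < s) (hs1 : s < 1) {n : ℕ}
    {f g k : (Fin n → ℝ) → ℝ} (hf : Continuous f) (hg : Continuous g) (hk : Continuous k)
    (hf0 : ∀ x, 0 < f x) (hg0 : ∀ x, 0 < g x) (hk0 : ∀ x, 0 < k x)
    (h : ∀ x ∈ Set.Icc (fun _ => -R) (fun _ => R), ∀ y ∈ Set.Icc (fun _ => -R) (fun _ => R),
      f x ^ (1 - s) * g y ^ s ≤ k ((1 - s) • x + s • y)) :
    (∫ x in Set.Icc (fun _ => -R) (fun _ => R), f x) ^ (1 - s) *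
      (∫ x in Set.Icc (fun _ => -R) (fun _ => R), g x) ^ s ≤
      ∫ x in Set.Icc (fun _ => -R) (fun _ => R), k x := by
  induction n with
  | zero =>
    have huniv : Set.Icc (fun _ : Fin 0 => -R) (fun _ => R) = Set.univ :=
      Set.eq_univ_of_forall fun x => ⟨fun i => i.elim0, fun i => i.elim0⟩
    have hint (u : (Fin 0 → ℝ) → ℝ) :
        ∫ x in Set.Icc (fun _ => -R) (fun _ => R), u x = u 0 := by
      rw [show u = fun _ => u 0 from funext fun x => congrArg u (Subsingleton.elim _ _)]
      simp [huniv, measureReal_def, volume_pi]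
    have := h 0 (huniv ▸ trivial) 0 (huniv ▸ trivial)
    rwa [smul_zero, smul_zero, add_zero, ← hint f, ← hint g, ← hint k] at this
  | succ n ih =>
    have hcons {u : (Fin (n + 1) → ℝ) → ℝ} (hu : Continuous u) :
        Continuous (Function.uncurry fun (t : ℝ) (x : Fin n → ℝ) => u (Fin.cons t x)) :=
      hu.comp (by fun_prop)
    have hcons' {u : (Fin (n + 1) → ℝ) → ℝ} (hu : Continuous u) (t : ℝ) :
        Continuous fun x : Fin n → ℝ => u (Fin.cons t x) := hu.comp (by fun_prop)
    rw [integral_cube_succ hf, integral_cube_succ hg, integral_cube_succ hk]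
    refine prekopa_leindler_Icc hR hs0 hs1
      (continuous_parametric_integral_of_continuous (hcons hf) isCompact_Icc)
      (continuous_parametric_integral_of_continuous (hcons hg) isCompact_Icc)
      (continuous_parametric_integral_of_continuous (hcons hk) isCompact_Icc)
      (fun t => integral_cube_pos hR (hcons' hf t) fun _ => hf0 _)
      (fun t => integral_cube_pos hR (hcons' hg t) fun _ => hg0 _)
      (fun t => integral_cube_pos hR (hcons' hk t) fun _ => hk0 _)
      (fun t ht u hu => ?_)
    refine ih (hcons' hf t) (hcons' hg u) (hcons' hk _) (fun _ => hf0 _) (fun _ => hg0 _)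
      (fun _ => hk0 _) (fun x hx y hy => ?_)
    have hmem {t : ℝ} {x : Fin n → ℝ} (ht : t ∈ Set.Icc (-R) R)
        (hx : x ∈ Set.Icc (fun _ => -R) (fun _ => R)) :
        (Fin.cons t x : Fin (n + 1) → ℝ) ∈ Set.Icc (fun _ => -R) (fun _ => R) :=
      ⟨Fin.cases ht.1 hx.1, Fin.cases ht.2 hx.2⟩
    convert h _ (hmem ht hx) _ (hmem hu hy) using 2
    ext i
    refine Fin.cases ?_ (fun j => ?_) i <;> simp

theorem bddAbove_range_inner_sub {n : ℕ} {φ : EuclideanSpace ℝ (Fin n) → ℝ} (hφ : Continuous φ)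
    (hcoer : Tendsto (fun x => φ x / ‖x‖) (cobounded (EuclideanSpace ℝ (Fin n))) atTop)
    (y : EuclideanSpace ℝ (Fin n)) : BddAbove (Set.range fun z => ⟪y, z⟫ - φ z) := by
  obtain ⟨r, -, hr⟩ := hasBasis_cobounded_norm.eventually_iff.1 (hcoer.eventually_ge_atTop ‖y‖)
  obtain ⟨M, hM⟩ := (isCompact_closedBall (0 : EuclideanSpace ℝ (Fin n)) r).bddAbove_image
    (f := fun z => ⟪y, z⟫ - φ z) (by fun_prop)
  refine ⟨max M (max 0 (-φ 0)), ?_⟩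
  rintro _ ⟨z, rfl⟩
  rcases le_total ‖z‖ r with hz | hz
  · exact (hM ⟨z, by simpa using hz, rfl⟩).trans (le_max_left _ _)
  · refine le_trans ?_ (le_max_right _ _)
    rcases eq_or_ne z 0 with rfl | hz0
    · simp
    · have h1 : ‖y‖ * ‖z‖ ≤ φ z := (le_div_iff₀ (norm_pos_iff.2 hz0)).1 (hr hz)
      have h2 := real_inner_le_norm y z
      exact le_trans (by simpa using by linarith) (le_max_left _ _)

theorem inner_sub_le_legendre {n : ℕ} {φ : EuclideanSpace ℝ (Fin n) → ℝ} (hφ : Continuous φ)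
    (hcoer : Tendsto (fun x => φ x / ‖x‖) (cobounded (EuclideanSpace ℝ (Fin n))) atTop)
    (y z : EuclideanSpace ℝ (Fin n)) : ⟪y, z⟫ - φ z ≤ legendre φ y :=
  le_ciSup (bddAbove_range_inner_sub hφ hcoer y) z

theorem continuous_legendre {n : ℕ} {φ : EuclideanSpace ℝ (Fin n) → ℝ} (hφ : Continuous φ)
    (hcoer : Tendsto (fun x => φ x / ‖x‖) (cobounded (EuclideanSpace ℝ (Fin n))) atTop) :
    Continuous (legendre φ) := by
  rw [← continuousOn_univ]
  refine ConvexOn.continuousOn isOpen_univ ⟨convex_univ, fun x _ y _ a b ha hb hab => ?_⟩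
  refine ciSup_le fun z => ?_
  calc ⟪a • x + b • y, z⟫ - φ z = a * (⟪x, z⟫ - φ z) + b * (⟪y, z⟫ - φ z) := by
        rw [inner_add_left, real_inner_smul_left, real_inner_smul_left]
        linear_combination φ z * hab
    _ ≤ a • legendre φ x + b • legendre φ y := by
        have h1 := inner_sub_le_legendre hφ hcoer x z
        have h2 := inner_sub_le_legendre hφ hcoer y z
        simp only [smul_eq_mul]
        gcongr

theorem legendre_eq_of_hasGradientAt {n : ℕ} {φ : EuclideanSpace ℝ (Fin n) → ℝ}
    (hφ : ConvexOn ℝ Set.univ φ) {x v : EuclideanSpace ℝ (Fin n)} (hv : HasGradientAt φ v x) :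
    legendre φ v = ⟪v, x⟫ - φ x := by
  have hle (z : EuclideanSpace ℝ (Fin n)) : ⟪v, z⟫ - φ z ≤ ⟪v, x⟫ - φ x := by
    have hconv : ConvexOn ℝ Set.univ (φ ∘ AffineMap.lineMap (k := ℝ) x z) := by
      simpa using hφ.comp_affineMap (AffineMap.lineMap x z)
    have hderiv : HasDerivAt (φ ∘ AffineMap.lineMap (k := ℝ) x z) ⟪v, z - x⟫ 0 := by
      have h0 : HasFDerivAt φ (InnerProductSpace.toDual ℝ _ v)
          (AffineMap.lineMap (k := ℝ) x z 0) := by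
        simpa using hv.hasFDerivAt
      simpa using h0.comp_hasDerivAt (0 : ℝ) AffineMap.hasDerivAt_lineMap
    have := hconv.le_slope_of_hasDerivAt trivial trivial zero_lt_one hderiv
    simp [slope_def_field, inner_sub_right] at this
    linarith
  exact le_antisymm (ciSup_le hle) (le_ciSup (f := fun z => ⟪v, z⟫ - φ z)
    ⟨_, Set.forall_mem_range.2 hle⟩ x)

/-- A `C¹` function is uniformly differentiable on compact convex sets. -/
theorem exists_forall_abs_sub_sub_inner_gradient_le {n : ℕ} {ψ : EuclideanSpace ℝ (Fin n) → ℝ}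
    (hψ : ContDiff ℝ 1 ψ) {K : Set (EuclideanSpace ℝ (Fin n))} (hK : IsCompact K)
    (hK' : Convex ℝ K) {ε : ℝ} (hε : 0 < ε) :
    ∃ δ > 0, ∀ x ∈ K, ∀ z ∈ K, ‖x - z‖ < δ →
      |ψ x - ψ z - ⟪gradient ψ z, x - z⟫| ≤ ε * ‖x - z‖ := by
  have huc := hK.uniformContinuousOn_of_continuous (hψ.continuous_fderiv one_ne_zero).continuousOn
  obtain ⟨δ, hδ, h⟩ := Metric.uniformContinuousOn_iff.1 huc ε hε
  refine ⟨δ, hδ, fun x hx z hz hxz => ?_⟩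
  have := (hK'.inter (convex_ball z δ)).norm_image_sub_le_of_norm_fderiv_le' (𝕜 := ℝ)
    (f := ψ) (φ := fderiv ℝ ψ z) (C := ε) (x := z) (y := x)
    (fun y _ => (hψ.differentiable one_ne_zero).differentiableAt)
    (fun y hy => by simpa [dist_eq_norm] using (h y hy.1 z hz hy.2).le)
    ⟨hz, Metric.mem_ball_self hδ⟩ ⟨hx, by simpa [dist_eq_norm] using hxz⟩
  rwa [← toDual_gradient, InnerProductSpace.toDual_apply_apply, Real.norm_eq_abs] at this

/-- The cube `[-R, R]ⁿ` as a subset of Euclidean space. -/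
def cube (n : ℕ) (R : ℝ) : Set (EuclideanSpace ℝ (Fin n)) :=
  WithLp.ofLp ⁻¹' Set.Icc (fun _ => -R) (fun _ => R)

theorem isCompact_cube (n : ℕ) (R : ℝ) : IsCompact (cube n R) :=
  (PiLp.homeomorph 2 fun _ : Fin n => ℝ).isCompact_preimage.2 isCompact_Icc

theorem convex_cube (n : ℕ) (R : ℝ) : Convex ℝ (cube n R) :=
  (convex_Icc _ _).linear_preimage (WithLp.linearEquiv 2 ℝ (Fin n → ℝ)).toLinearMap

theorem setIntegral_cube {n : ℕ} {R : ℝ} (f : EuclideanSpace ℝ (Fin n) → ℝ) :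
    ∫ x in cube n R, f x =
      ∫ x in Set.Icc (fun _ => -R) (fun _ => R), f (WithLp.toLp 2 x) :=
  ((PiLp.volume_preserving_toLp (Fin n)).setIntegral_preimage_emb
    (MeasurableEquiv.toLp 2 (Fin n → ℝ)).measurableEmbedding f (cube n R)).symm

theorem setIntegral_cube_pos {n : ℕ} {R : ℝ} (hR : 0 < R) {f : EuclideanSpace ℝ (Fin n) → ℝ}
    (hf : Continuous f) (hf0 : ∀ x, 0 < f x) : 0 < ∫ x in cube n R, f x := by
  rw [setIntegral_cube]
  exact integral_cube_pos hR (by fun_prop) fun x => hf0 _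

theorem aecover_cube (n : ℕ) :
    AECover (volume : Measure (EuclideanSpace ℝ (Fin n))) atTop (cube n) where
  ae_eventually_mem := .of_forall fun x => by
    filter_upwards [eventually_ge_atTop ‖x‖] with R hR
    have h (i : Fin n) := abs_le.1 ((PiLp.norm_apply_le x i).trans hR)
    exact ⟨fun i => (h i).1, fun i => (h i).2⟩
  measurableSet R := (isCompact_cube n R).measurableSet

/-- The infimal convolution bound behind the linearization of the Prékopa–Leindler inequality. -/
theorem exists_forall_sub_mul_le_convex_combination {n : ℕ} {R : ℝ}
    {φ ψ L : EuclideanSpace ℝ (Fin n) → ℝ}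
    (hψ : ContDiff ℝ 1 ψ) (hLφ : ∀ y z, ⟪y, z⟫ - φ z ≤ L y) {η : ℝ} (hη : 0 < η) :
    ∃ s₀ > 0, ∀ s, 0 < s → s < s₀ → s < 1 → ∀ x ∈ cube n R, ∀ y ∈ cube n R,
      ∀ z, z = (1 - s) • x + s • y →
      ψ z - s * (L (gradient ψ z) - ⟪z, gradient ψ z⟫ + ψ z + η) ≤ (1 - s) * ψ x + s * φ y := by
  obtain ⟨D, hD⟩ := (isCompact_cube n R).isBounded.exists_norm_le
  have hD1 : 0 < 2 * |D| + 1 := by positivity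
  obtain ⟨δ, hδ, h⟩ := exists_forall_abs_sub_sub_inner_gradient_le hψ (isCompact_cube n R)
    (convex_cube n R) (div_pos hη hD1)
  refine ⟨δ / (2 * |D| + 1), div_pos hδ hD1, fun s hs0 hsδ hs1 x hx y hy z hz => ?_⟩
  have hs1' := sub_pos.2 hs1
  have hzmem : z ∈ cube n R := hz ▸ convex_cube n R hx hy hs1'.le hs0.le (by ring)
  have hxz : x - z = s • (x - y) := by rw [hz]; module
  have hzy : (1 - s) • (x - z) = s • (z - y) := by rw [hz]; module
  have hxy : ‖x - y‖ ≤ 2 * |D| + 1 := by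
    have := norm_sub_le x y
    have := hD x hx
    have := hD y hy
    have := le_abs_self D
    linarith
  have hnorm : ‖x - z‖ ≤ s * (2 * |D| + 1) := by
    rw [hxz, norm_smul, Real.norm_of_nonneg hs0.le]
    gcongr
  have h1 := (abs_le.1 (h x hx z hzmem (hnorm.trans_lt ((lt_div_iff₀ hD1).1 hsδ)))).1
  have h2 : η / (2 * |D| + 1) * ‖x - z‖ ≤ s * η := by
    calc _ ≤ η / (2 * |D| + 1) * (s * (2 * |D| + 1)) := by gcongr
      _ = s * η := by field_simp
  have h3 : (1 - s) * ⟪gradient ψ z, x - z⟫ = s * (⟪z, gradient ψ z⟫ - ⟪gradient ψ z, y⟫) := by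
    rw [← real_inner_smul_right, hzy, real_inner_smul_right, inner_sub_right,
      real_inner_comm z]
  have h4 := mul_le_mul_of_nonneg_left (hLφ (gradient ψ z) y) hs0.le
  have h5 : (1 - s) * (ψ z + ⟪gradient ψ z, x - z⟫ - s * η) ≤ (1 - s) * ψ x := by
    gcongr; linarith
  have h6 : 0 ≤ s * (s * η) := by positivity
  linarith [h3, h4, h5, h6]

theorem prekopa_leindler_setIntegral_cube {R s : ℝ} (hR : 0 < R) (hs0 : 0 < s) (hs1 : s < 1)
    {n : ℕ} {f g k : EuclideanSpace ℝ (Fin n) → ℝ} (hf : Continuous f) (hg : Continuous g)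
    (hk : Continuous k) (hf0 : ∀ x, 0 < f x) (hg0 : ∀ x, 0 < g x) (hk0 : ∀ x, 0 < k x)
    (h : ∀ x ∈ cube n R, ∀ y ∈ cube n R, f x ^ (1 - s) * g y ^ s ≤ k ((1 - s) • x + s • y)) :
    (∫ x in cube n R, f x) ^ (1 - s) * (∫ x in cube n R, g x) ^ s ≤ ∫ x in cube n R, k x := by
  simp only [setIntegral_cube]
  exact prekopa_leindler_cube hR hs0 hs1 (f := fun x => f (WithLp.toLp 2 x))
    (g := fun x => g (WithLp.toLp 2 x)) (k := fun x => k (WithLp.toLp 2 x))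
    (by fun_prop) (by fun_prop) (by fun_prop)
    (fun _ => hf0 _) (fun _ => hg0 _) (fun _ => hk0 _)
    fun x hx y hy => h (WithLp.toLp 2 x) hx (WithLp.toLp 2 y) hy

theorem continuous_gradient {n : ℕ} {ψ : EuclideanSpace ℝ (Fin n) → ℝ} (hψ : ContDiff ℝ 1 ψ) :
    Continuous (gradient ψ) :=
  (InnerProductSpace.toDual ℝ _).symm.continuous.comp (hψ.continuous_fderiv one_ne_zero)

open scoped Topology in
/-- The linearized Prékopa–Leindler inequality on a cube. -/
theorem mul_log_div_le_setIntegral_cube {n : ℕ} {R : ℝ} (hR : 0 < R)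
    {φ ψ L : EuclideanSpace ℝ (Fin n) → ℝ} (hφ : Continuous φ) (hψ : ContDiff ℝ 1 ψ)
    (hL : Continuous L) (hLφ : ∀ y z, ⟪y, z⟫ - φ z ≤ L y) :
    (∫ x in cube n R, exp (-ψ x)) *
        log ((∫ x in cube n R, exp (-φ x)) / ∫ x in cube n R, exp (-ψ x)) ≤
      ∫ x in cube n R, (L (gradient ψ x) - ⟪x, gradient ψ x⟫ + ψ x) * exp (-ψ x) := by
  have hψc := hψ.continuous
  have hgrad := continuous_gradient hψ
  set Z := ∫ x in cube n R, exp (-ψ x)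
  set m := ∫ x in cube n R, exp (-φ x)
  have hZ : 0 < Z := setIntegral_cube_pos hR (by fun_prop) fun _ => exp_pos _
  have hm : 0 < m := setIntegral_cube_pos hR (by fun_prop) fun _ => exp_pos _
  set w := fun x => L (gradient ψ x) - ⟪x, gradient ψ x⟫ + ψ x
  have hw : Continuous w := by fun_prop
  have hint {u : EuclideanSpace ℝ (Fin n) → ℝ} (hu : Continuous u) : IntegrableOn u (cube n R) :=
    hu.continuousOn.integrableOn_compact (isCompact_cube n R)
  have hintw := hint (u := fun x => w x * exp (-ψ x)) (by fun_prop)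
  have hintψ := hint (u := fun x => exp (-ψ x)) (by fun_prop)
  have hη (η : ℝ) (hη : 0 < η) :
      Z * log (m / Z) ≤ (∫ x in cube n R, w x * exp (-ψ x)) + Z * η := by
    obtain ⟨B, hB⟩ := (isCompact_cube n R).exists_bound_of_continuousOn
      (f := fun x => w x + η) (by fun_prop)
    obtain ⟨s₀, hs₀, hs⟩ := exists_forall_sub_mul_le_convex_combination (R := R) hψ hLφ hη
    have hsmall : ∀ᶠ s in 𝓝[>] (0 : ℝ), Z * log (m / Z) ≤
        (∫ x in cube n R, w x * exp (-ψ x)) + Z * η + s * (B ^ 2 * Z) := by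
      have hsB : ∀ᶠ s in 𝓝[>] (0 : ℝ), s * |B| < 1 := by
        refine nhdsWithin_le_nhds (ContinuousAt.eventually_lt (by fun_prop) (by fun_prop) ?_)
        simp
      filter_upwards [self_mem_nhdsWithin, nhdsWithin_le_nhds (eventually_lt_nhds hs₀),
        nhdsWithin_le_nhds (eventually_lt_nhds one_pos), hsB] with s hs0 hss₀ hs1 hsB
      replace hs0 : 0 < s := hs0
      have hPL := prekopa_leindler_setIntegral_cube hR hs0 hs1 (f := fun x => exp (-ψ x))
        (g := fun x => exp (-φ x)) (k := fun x => exp (-(ψ x - s * (w x + η))))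
        (by fun_prop) (by fun_prop) (by fun_prop)
        (fun _ => exp_pos _) (fun _ => exp_pos _) (fun _ => exp_pos _)
        (fun x hx y hy => by
          rw [← exp_mul, ← exp_mul, ← exp_add, exp_le_exp]
          linarith [hs s hs0 hss₀ hs1 x hx y hy _ rfl])
      have hlower : Z * (1 + s * log (m / Z)) ≤ Z ^ (1 - s) * m ^ s := by
        have : Z ^ (1 - s) * m ^ s = Z * exp (s * log (m / Z)) := by
          rw [log_div hm.ne' hZ.ne', rpow_def_of_pos hZ, rpow_def_of_pos hm]
          nth_rw 2 [← exp_log hZ]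
          rw [← exp_add, ← exp_add]
          congr 1
          ring
        rw [this]
        gcongr
        linarith [add_one_le_exp (s * log (m / Z))]
      have hupper : ∫ x in cube n R, exp (-(ψ x - s * (w x + η))) ≤
          ∫ x in cube n R, (exp (-ψ x) * (1 + s * η + s ^ 2 * B ^ 2) +
            s * (w x * exp (-ψ x))) := by
        refine setIntegral_mono_on (hint (by fun_prop)) (hint (by fun_prop))
          (isCompact_cube n R).measurableSet fun x hx => ?_
        have hb : |w x + η| ≤ B := hB x hx
        have hb1 : |s * (w x + η)| ≤ 1 := by
          rw [abs_mul, abs_of_pos hs0]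
          exact (mul_le_mul_of_nonneg_left (hb.trans (le_abs_self B)) hs0.le).trans hsB.le
        have hexp := (abs_le.1 (abs_exp_sub_one_sub_id_le hb1)).2
        have hsq : (s * (w x + η)) ^ 2 ≤ s ^ 2 * B ^ 2 := by
          rw [mul_pow]
          gcongr ?_ * ?_
          exact sq_le_sq' (by linarith [(abs_le.1 hb).1]) (abs_le.1 hb).2
        rw [neg_sub, sub_eq_neg_add, exp_add]
        calc exp (-ψ x) * exp (s * (w x + η))
            ≤ exp (-ψ x) * (1 + s * (w x + η) + s ^ 2 * B ^ 2) := by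
              gcongr; linarith
          _ = _ := by ring
      rw [integral_add (hintψ.mul_const _) (hintw.const_mul _), integral_mul_const,
        integral_const_mul] at hupper
      have := hlower.trans (hPL.trans hupper)
      refine le_of_mul_le_mul_left ?_ hs0
      linarith
    have hlim : Tendsto (fun s : ℝ => (∫ x in cube n R, w x * exp (-ψ x)) + Z * η +
        s * (B ^ 2 * Z)) (𝓝[>] 0) (𝓝 ((∫ x in cube n R, w x * exp (-ψ x)) + Z * η)) := by
      refine tendsto_nhdsWithin_of_tendsto_nhds ?_
      exact Continuous.tendsto' (by fun_prop) _ _ (by simp)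
    exact ge_of_tendsto hlim hsmall
  refine le_of_forall_pos_le_add fun ε hε => ?_
  have := hη (ε / Z) (div_pos hε hZ)
  rwa [mul_div_cancel₀ ε hZ.ne'] at this

/-- The linearized Prékopa–Leindler inequality. -/
theorem neg_mul_log_le_integral {n : ℕ} {φ ψ L : EuclideanSpace ℝ (Fin n) → ℝ}
    (hφ : Continuous φ) (hψ : ContDiff ℝ 1 ψ) (hL : Continuous L)
    (hLφ : ∀ y z, ⟪y, z⟫ - φ z ≤ L y) (hφ1 : ∫ x, exp (-φ x) = 1)
    (hψint : Integrable fun x => exp (-ψ x))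
    (hint : Integrable fun x =>
      (L (gradient ψ x) - ⟪x, gradient ψ x⟫ + ψ x) * exp (-ψ x)) :
    -((∫ x, exp (-ψ x)) * log (∫ x, exp (-ψ x))) ≤
      ∫ x, (L (gradient ψ x) - ⟪x, gradient ψ x⟫ + ψ x) * exp (-ψ x) := by
  have hφint : Integrable fun x => exp (-φ x) :=
    Integrable.of_integral_ne_zero (by rw [hφ1]; exact one_ne_zero)
  have hcover := aecover_cube n
  have hZ : (∫ x, exp (-ψ x)) ≠ 0 := (integral_exp_pos hψint).ne'
  have hZlim := hcover.integral_tendsto_of_countably_generated hψint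
  have hlim := hZlim.mul (((hcover.integral_tendsto_of_countably_generated hφint).div hZlim hZ).log
    (div_ne_zero (by rw [hφ1]; exact one_ne_zero) hZ))
  rw [hφ1, one_div, log_inv, mul_neg] at hlim
  refine le_of_tendsto_of_tendsto hlim (hcover.integral_tendsto_of_countably_generated hint) ?_
  filter_upwards [eventually_gt_atTop 0] with R hR
  exact mul_log_div_le_setIntegral_cube hR hφ hψ hL hLφ

theorem modified_log_sobolev (n : ℕ) (φ : EuclideanSpace ℝ (Fin n) → ℝ)
    (hφ : ContDiff ℝ 1 φ) (hconv : StrictConvexOn ℝ Set.univ φ)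
    (hcoer : Tendsto (fun x => φ x / ‖x‖) (cobounded (EuclideanSpace ℝ (Fin n))) atTop)
    (hnorm : ∫ x, Real.exp (-φ x) = 1)
    (μ : Measure (EuclideanSpace ℝ (Fin n)))
    (hμ : μ = volume.withDensity fun x => ENNReal.ofReal (Real.exp (-φ x)))
    (g : EuclideanSpace ℝ (Fin n) → ℝ) (hg : ContDiff ℝ 1 g)
    (hint1 : Integrable (fun x => Real.exp (g x)) μ)
    (hint2 : Integrable (fun x =>
      Real.exp (g x) * Real.log (Real.exp (g x) / ∫ y, Real.exp (g y) ∂μ)) μ)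
    (hint3 : Integrable (fun x =>
      (⟪x, gradient g x⟫ - legendre φ (gradient φ x)
        + legendre φ (gradient φ x - gradient g x)) * Real.exp (g x)) μ) :
    Ent μ (fun x => Real.exp (g x)) ≤
      ∫ x, (⟪x, gradient g x⟫ - legendre φ (gradient φ x)
        + legendre φ (gradient φ x - gradient g x)) * Real.exp (g x) ∂μ := by
  have hφc := hφ.continuous
  have hmeas : Measurable fun x => ENNReal.ofReal (exp (-φ x)) := by fun_prop
  have hfin : ∀ᵐ x, ENNReal.ofReal (exp (-φ x)) < ⊤ := .of_forall fun _ => ENNReal.ofReal_lt_top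
  have hiff (u : EuclideanSpace ℝ (Fin n) → ℝ) :
      Integrable u μ ↔ Integrable fun x => u x * exp (-φ x) := by
    simp only [hμ, integrable_withDensity_iff hmeas hfin, ENNReal.toReal_ofReal (exp_pos _).le]
  have hintegral (u : EuclideanSpace ℝ (Fin n) → ℝ) :
      ∫ x, u x ∂μ = ∫ x, u x * exp (-φ x) := by
    simp only [hμ, integral_withDensity_eq_integral_toReal_smul hmeas hfin,
      ENNReal.toReal_ofReal (exp_pos _).le, smul_eq_mul, mul_comm]
  set ψ := fun x => φ x - g x
  have hψ : ContDiff ℝ 1 ψ := hφ.sub hg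
  have hgradφ (x) : HasGradientAt φ (gradient φ x) x :=
    (hφ.differentiable one_ne_zero).differentiableAt.hasGradientAt
  have hgradg (x) : HasGradientAt g (gradient g x) x :=
    (hg.differentiable one_ne_zero).differentiableAt.hasGradientAt
  have hgradψ (x) : gradient ψ x = gradient φ x - gradient g x := by
    refine HasGradientAt.gradient (hasGradientAt_iff_hasFDerivAt.2 ?_)
    rw [map_sub]
    exact (hgradφ x).hasFDerivAt.sub (hgradg x).hasFDerivAt
  have hexp (x) : exp (g x) * exp (-φ x) = exp (-ψ x) := by
    rw [← exp_add]; congr 1; simp only [ψ]; ring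
  have hψint : Integrable fun x => exp (-ψ x) := by simpa only [hexp] using (hiff _).1 hint1
  have hZ : ∫ y, exp (g y) ∂μ = ∫ x, exp (-ψ x) := by simp only [hintegral, hexp]
  have hZpos : 0 < ∫ x, exp (-ψ x) := integral_exp_pos hψint
  rw [hZ] at hint2
  unfold Ent
  rw [hZ, ← sub_nonneg, ← integral_sub hint3 hint2, hintegral]
  have hdiff := (hiff _).1 (hint3.sub hint2)
  simp only [Pi.sub_apply] at hdiff
  have hpt (x) : ((⟪x, gradient g x⟫ - legendre φ (gradient φ x)
        + legendre φ (gradient φ x - gradient g x)) * exp (g x)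
        - exp (g x) * log (exp (g x) / ∫ x, exp (-ψ x))) * exp (-φ x) =
      (legendre φ (gradient ψ x) - ⟪x, gradient ψ x⟫ + ψ x) * exp (-ψ x) +
        log (∫ x, exp (-ψ x)) * exp (-ψ x) := by
    rw [legendre_eq_of_hasGradientAt hconv.convexOn (hgradφ x), hgradψ,
      log_div (exp_pos _).ne' hZpos.ne', log_exp, inner_sub_right,
      real_inner_comm x (gradient φ x), ← hexp]
    simp only [ψ]
    ring
  simp only [hpt] at hdiff ⊢
  have hint : Integrable fun x =>
      (legendre φ (gradient ψ x) - ⟪x, gradient ψ x⟫ + ψ x) * exp (-ψ x) := by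
    simpa only [Pi.sub_def, add_sub_cancel_right] using hdiff.sub (hψint.const_mul (log (∫ x, exp (-ψ x))))
  have key := neg_mul_log_le_integral hφc hψ (continuous_legendre hφc hcoer)
    (inner_sub_le_legendre hφc hcoer) hnorm hψint hint
  rw [integral_add hint (hψint.const_mul _), integral_const_mul]
  linarith
end

section
/- Let φ : ℝⁿ → ℝ be C¹, strictly convex, with φ(x)/‖x‖ → ∞ at infinity and ∫ e^{-φ} dx = 1. Let U : ℝⁿ → ℝ be bounded, Φ = φ + U, and μ_Φ(dx) = e^{-Φ(x)} dx / Z_Φ with Z_Φ = ∫ e^{-Φ} dx. Then for all smooth enough g, Ent_{μ_Φ}(e^g) ≤ e^{2·osc(U)} ∫ [x·∇g(x) − φ*(∇φ(x)) + φ*(∇φ(x) − ∇g(x))] e^{g(x)} dμ_Φ(x), where osc(U) = sup U − inf U. -/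
open MeasureTheory Real Filter Bornology
open scoped RealInnerProductSpace

theorem volume_add_le_of_isCompact {A B C : Set ℝ} (hA : IsCompact A) (hB : IsCompact B)
    (hA' : A.Nonempty) (hB' : B.Nonempty) (h : ∀ x ∈ A, ∀ y ∈ B, x + y ∈ C) :
    volume A + volume B ≤ volume C := by
  set a := sSup A
  set b := sInf B
  have ha : a ∈ A := hA.sSup_mem hA'
  have hb : b ∈ B := hB.sInf_mem hB'
  have hinter : volume ((fun x => x + b) '' A ∩ (fun y => a + y) '' B) = 0 := by
    refine measure_mono_null (t := {a + b}) ?_ (by simp)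
    rintro _ ⟨⟨x, hx, rfl⟩, ⟨y, hy, hxy⟩⟩
    have h1 : x ≤ a := le_csSup hA.bddAbove hx
    have h2 : b ≤ y := csInf_le hB.bddBelow hy
    simp only [Set.mem_singleton_iff] at hxy ⊢
    linarith
  have hmeas : MeasurableSet ((fun y => a + y) '' B) :=
    (hB.image (by fun_prop)).measurableSet
  calc volume A + volume B
      = volume ((fun x => x + b) '' A) + volume ((fun y => a + y) '' B) := by
        rw [Set.image_add_right, Set.image_add_left, measure_preimage_add_right,
          measure_preimage_add]
    _ = volume ((fun x => x + b) '' A ∪ (fun y => a + y) '' B) := by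
        rw [← measure_union_add_inter _ hmeas, hinter, add_zero]
    _ ≤ volume C := by
        refine measure_mono (Set.union_subset ?_ ?_)
        · rintro _ ⟨x, hx, rfl⟩
          exact h x hx b hb
        · rintro _ ⟨y, hy, rfl⟩
          exact h a ha y hy

/-- The one-dimensional Brunn–Minkowski inequality. -/
theorem volume_add_le_of_add_mem {A B C : Set ℝ} (hA : MeasurableSet A) (hB : MeasurableSet B)
    (hA' : A.Nonempty) (hB' : B.Nonempty) (h : ∀ x ∈ A, ∀ y ∈ B, x + y ∈ C) :
    volume A + volume B ≤ volume C := by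
  obtain ⟨a, ha⟩ := hA'
  obtain ⟨b, hb⟩ := hB'
  rw [hA.measure_eq_iSup_isCompact, hB.measure_eq_iSup_isCompact]
  simp only [iSup_and']
  refine ENNReal.biSup_add_biSup_le' ⟨∅, by simp⟩ ⟨∅, by simp⟩ fun K hK L hL => ?_
  calc volume K + volume L ≤ volume (insert a K) + volume (insert b L) := by
        gcongr <;> exact Set.subset_insert _ _
    _ ≤ volume C := by
        refine volume_add_le_of_isCompact (hK.2.insert a) (hL.2.insert b)
          (Set.insert_nonempty _ _) (Set.insert_nonempty _ _) fun x hx y hy => h x ?_ y ?_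
        · exact Set.insert_subset ha hK.1 hx
        · exact Set.insert_subset hb hL.1 hy

theorem ENNReal.rpow_mul_rpow_le_add {t : ℝ} (h0 : 0 < t) (h1 : t < 1) (a b : ENNReal) :
    a ^ (1 - t) * b ^ t ≤ ENNReal.ofReal (1 - t) * a + ENNReal.ofReal t * b := by
  have hp : (1 - t)⁻¹.HolderConjugate t⁻¹ := by
    rw [Real.holderConjugate_iff]
    refine ⟨(one_lt_inv₀ (by linarith)).2 (by linarith), by simp⟩
  have := ENNReal.young_inequality (a ^ (1 - t)) (b ^ t) hp
  rw [← ENNReal.rpow_mul, ← ENNReal.rpow_mul, mul_inv_cancel₀ (by linarith),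
    mul_inv_cancel₀ h0.ne', ENNReal.rpow_one, ENNReal.rpow_one,
    ENNReal.ofReal_inv_of_pos (by linarith), ENNReal.ofReal_inv_of_pos h0, div_eq_mul_inv,
    div_eq_mul_inv, inv_inv, inv_inv] at this
  rwa [mul_comm (ENNReal.ofReal (1 - t)), mul_comm (ENNReal.ofReal t)]

/-- One-dimensional Prékopa–Leindler inequality for functions whose supremum is one, in its
stronger arithmetic-mean form. -/
theorem prekopaLeindler_real_of_le_one {t : ℝ} (h0 : 0 < t) (h1 : t < 1) {F G H : ℝ → ℝ}
    (hF : Measurable F) (hG : Measurable G) (hH : Measurable H)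
    (hF0 : ∀ x, 0 ≤ F x) (hG0 : ∀ x, 0 ≤ G x) (hH0 : ∀ x, 0 ≤ H x)
    (hF1 : ∀ x, F x ≤ 1) (hG1 : ∀ x, G x ≤ 1)
    (hFs : ∀ r < 1, ∃ x, r < F x) (hGs : ∀ r < 1, ∃ x, r < G x)
    (h : ∀ x y, F x ^ (1 - t) * G y ^ t ≤ H ((1 - t) * x + t * y)) :
    ENNReal.ofReal (1 - t) * (∫⁻ x, ENNReal.ofReal (F x))
      + ENNReal.ofReal t * (∫⁻ x, ENNReal.ofReal (G x)) ≤ ∫⁻ x, ENNReal.ofReal (H x) := by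
  rw [lintegral_eq_lintegral_meas_lt _ (ae_of_all _ hF0) hF.aemeasurable,
    lintegral_eq_lintegral_meas_lt _ (ae_of_all _ hG0) hG.aemeasurable,
    lintegral_eq_lintegral_meas_lt _ (ae_of_all _ hH0) hH.aemeasurable]
  have hanti : ∀ K : ℝ → ℝ, Measurable fun r => volume {x | r < K x} := fun K =>
    Antitone.measurable fun r s hrs => measure_mono fun x hx => lt_of_le_of_lt hrs hx
  rw [← lintegral_const_mul _ (hanti F), ← lintegral_const_mul _ (hanti G),
    ← lintegral_add_left ((hanti F).const_mul _)]
  refine setLIntegral_mono' measurableSet_Ioi fun r hr => ?_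
  rw [Set.mem_Ioi] at hr
  rcases lt_or_ge r 1 with hr1 | hr1
  · have hsF : MeasurableSet {x | r < F x} := measurableSet_lt measurable_const hF
    have hsG : MeasurableSet {x | r < G x} := measurableSet_lt measurable_const hG
    have key := volume_add_le_of_add_mem (A := (fun x => (1 - t)⁻¹ * x) ⁻¹' {x | r < F x})
      (B := (fun x => t⁻¹ * x) ⁻¹' {x | r < G x}) (C := {x | r < H x})
      (hsF.preimage (by fun_prop)) (hsG.preimage (by fun_prop)) ?_ ?_ ?_
    · rw [Real.volume_preimage_mul_left (inv_ne_zero (by linarith)),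
        Real.volume_preimage_mul_left (inv_ne_zero h0.ne'), inv_inv, inv_inv, abs_of_pos h0,
        abs_of_pos (by linarith : 0 < 1 - t)] at key
      exact key
    · obtain ⟨x, hx⟩ := hFs r hr1
      refine ⟨(1 - t) * x, ?_⟩
      simpa [inv_mul_cancel_left₀ (by linarith : 1 - t ≠ 0)] using hx
    · obtain ⟨x, hx⟩ := hGs r hr1
      refine ⟨t * x, ?_⟩
      simpa [inv_mul_cancel_left₀ h0.ne'] using hx
    · intro x hx y hy
      simp only [Set.mem_preimage, Set.mem_ofPred_eq] at hx hy ⊢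
      have := h ((1 - t)⁻¹ * x) (t⁻¹ * y)
      rw [mul_inv_cancel_left₀ (by linarith), mul_inv_cancel_left₀ h0.ne'] at this
      refine lt_of_lt_of_le ?_ this
      calc r = r ^ (1 - t) * r ^ t := by
            rw [← Real.rpow_add hr, sub_add_cancel, Real.rpow_one]
        _ < _ := by
            refine mul_lt_mul'' (Real.rpow_lt_rpow hr.le hx (by linarith))
              (Real.rpow_lt_rpow hr.le hy h0) (by positivity) (by positivity)
  · have e1 : {x | r < F x} = ∅ := by
      ext x; simpa using (hF1 x).trans hr1
    have e2 : {x | r < G x} = ∅ := by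
      ext x; simpa using (hG1 x).trans hr1
    simp [e1, e2]

/-- A measure space with a linear structure satisfies the Prékopa–Leindler inequality with
weights `1 - t` and `t`. -/
def PrekopaLeindler (t : ℝ) (E : Type*) [AddCommGroup E] [Module ℝ E] [MeasureSpace E] : Prop :=
  ∀ f g h : E → ENNReal, Measurable f → Measurable g → Measurable h →
    (∀ x y, f x ^ (1 - t) * g y ^ t ≤ h ((1 - t) • x + t • y)) →
    (∫⁻ x, f x) ^ (1 - t) * (∫⁻ x, g x) ^ t ≤ ∫⁻ x, h x

theorem prekopaLeindler_real_of_bounded {t : ℝ} (h0 : 0 < t) (h1 : t < 1) {f g h : ℝ → ENNReal}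
    (hf : Measurable f) (hg : Measurable g) (hh : Measurable h)
    (hft : ⨆ x, f x ≠ ⊤) (hgt : ⨆ x, g x ≠ ⊤)
    (H : ∀ x y, f x ^ (1 - t) * g y ^ t ≤ h ((1 - t) * x + t * y)) :
    (∫⁻ x, f x) ^ (1 - t) * (∫⁻ x, g x) ^ t ≤ ∫⁻ x, h x := by
  have h1' : 0 < 1 - t := by linarith
  set a := ⨆ x, f x with ha
  set b := ⨆ x, g x with hb
  rcases eq_or_ne a 0 with ha0 | ha0
  · have : ∀ x, f x = 0 := by simpa [ha] using ha0
    simp [this, h1']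
  rcases eq_or_ne b 0 with hb0 | hb0
  · have : ∀ x, g x = 0 := by simpa [hb] using hb0
    simp [this, h0]
  set c := a ^ (1 - t) * b ^ t with hc
  have hc0 : c ≠ 0 := mul_ne_zero (by simp [ha0, hft]) (by simp [hb0, hgt])
  have hct : c ≠ ⊤ := ENNReal.mul_ne_top (ENNReal.rpow_ne_top_of_nonneg h1'.le hft)
    (ENNReal.rpow_ne_top_of_nonneg h0.le hgt)
  have hdiv : ∀ x y : ENNReal, x / a ^ (1 - t) * (y / b ^ t) = x * y / c := by
    intro x y
    rw [div_eq_mul_inv, div_eq_mul_inv, div_eq_mul_inv, hc, ENNReal.mul_inv (by simp [ha0, hft])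
      (by simp [hb0, hgt])]
    ring
  have hle : ∀ (k : ℝ → ENNReal) (m : ENNReal), m = ⨆ x, k x → ∀ x, k x / m ≤ 1 := by
    intro k m hm x
    exact ENNReal.div_le_of_le_mul (by rw [one_mul, hm]; exact le_iSup k x)
  have hsup : ∀ (k : ℝ → ENNReal) (m : ENNReal), m = ⨆ x, k x → m ≠ 0 → m ≠ ⊤ →
      ∀ r < 1, ∃ x, r < (k x / m).toReal := by
    intro k m hm hm0 hmt r hr
    have : ENNReal.ofReal r * m < ⨆ x, k x := by
      rw [← hm]
      calc ENNReal.ofReal r * m < 1 * m :=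
            ENNReal.mul_lt_mul_left hm0 hmt (by simpa using hr)
        _ = m := one_mul m
    obtain ⟨x, hx⟩ := lt_iSup_iff.1 this
    refine ⟨x, ?_⟩
    by_contra! hle'
    rw [← ENNReal.lt_div_iff_mul_lt (.inl hm0) (.inl hmt)] at hx
    refine hx.not_ge ?_
    rw [← ENNReal.ofReal_toReal ((hle k m hm x).trans_lt ENNReal.one_lt_top).ne]
    exact ENNReal.ofReal_le_ofReal hle'
  have key := prekopaLeindler_real_of_le_one h0 h1 (F := fun x => (f x / a).toReal)
    (G := fun x => (g x / b).toReal) (H := fun x => (min (h x / c) 1).toReal)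
    (by fun_prop) (by fun_prop) (by fun_prop) (fun _ => ENNReal.toReal_nonneg)
    (fun _ => ENNReal.toReal_nonneg) (fun _ => ENNReal.toReal_nonneg)
    (fun x => ENNReal.toReal_le_of_le_ofReal zero_le_one (by simpa using hle f a ha x))
    (fun x => ENNReal.toReal_le_of_le_ofReal zero_le_one (by simpa using hle g b hb x))
    (hsup f a ha ha0 hft) (hsup g b hb hb0 hgt) ?_
  · have e : ∀ (k : ℝ → ENNReal) (m : ENNReal), Measurable k → m = ⨆ x, k x →
        ∫⁻ x, ENNReal.ofReal (k x / m).toReal = (∫⁻ x, k x) / m := by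
      intro k m hk hm
      simp_rw [div_eq_mul_inv]
      rw [← lintegral_mul_const _ hk]
      refine lintegral_congr fun x => ENNReal.ofReal_toReal ?_
      exact ((hle k m hm x).trans_lt ENNReal.one_lt_top).ne
    rw [e f a hf ha, e g b hg hb] at key
    have e3 : ∫⁻ x, ENNReal.ofReal (min (h x / c) 1).toReal ≤ (∫⁻ x, h x) / c := by
      simp_rw [div_eq_mul_inv]
      rw [← lintegral_mul_const _ hh]
      exact lintegral_mono fun x => ENNReal.ofReal_toReal_le.trans (min_le_left _ _)
    have := (ENNReal.rpow_mul_rpow_le_add h0 h1 _ _).trans (key.trans e3)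
    rw [ENNReal.div_rpow_of_nonneg _ _ h1'.le, ENNReal.div_rpow_of_nonneg _ _ h0.le, hdiv] at this
    simpa [ENNReal.div_mul_cancel hc0 hct] using mul_le_mul' this (le_refl c)
  · intro x y
    rw [ENNReal.toReal_rpow, ENNReal.toReal_rpow, ← ENNReal.toReal_mul]
    refine ENNReal.toReal_mono (by simp) (le_min ?_ ?_)
    · rw [ENNReal.div_rpow_of_nonneg _ _ h1'.le, ENNReal.div_rpow_of_nonneg _ _ h0.le, hdiv]
      gcongr
      exact H x y
    · exact mul_le_one' (ENNReal.rpow_le_one (hle f a ha x) h1'.le)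
        (ENNReal.rpow_le_one (hle g b hb y) h0.le)

theorem prekopaLeindler_real {t : ℝ} (h0 : 0 < t) (h1 : t < 1) : PrekopaLeindler t ℝ := by
  intro f g h hf hg hh H
  have trunc : ∀ k : ℝ → ENNReal, Measurable k →
      Tendsto (fun n : ℕ => ∫⁻ x, min (k x) n) atTop (nhds (∫⁻ x, k x)) := by
    intro k hk
    refine lintegral_tendsto_of_tendsto_of_monotone (fun n => by fun_prop) ?_ ?_
    · exact ae_of_all _ fun x m n hmn => min_le_min le_rfl (by exact_mod_cast hmn)
    · refine ae_of_all _ fun x => ?_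
      simpa using tendsto_const_nhds.min ENNReal.tendsto_nat_nhds_top
  have bdd : ∀ (k : ℝ → ENNReal) (n : ℕ), ⨆ x, min (k x) n ≠ ⊤ := fun k n =>
    ((iSup_le fun x => min_le_right _ _).trans_lt (ENNReal.natCast_lt_top n)).ne
  rcases eq_or_ne (∫⁻ x, f x) 0 with hf0 | hf0
  · simp [hf0, h1]
  rcases eq_or_ne (∫⁻ x, g x) 0 with hg0 | hg0
  · simp [hg0, h0]
  refine le_of_tendsto' (x := atTop) (f := fun n : ℕ =>
    (∫⁻ x, min (f x) n) ^ (1 - t) * (∫⁻ x, min (g x) n) ^ t) ?_ fun n => ?_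
  · exact ENNReal.Tendsto.mul ((ENNReal.continuous_rpow_const.tendsto _).comp (trunc f hf))
      (.inl (by simp [hf0, h1.le, h1])) ((ENNReal.continuous_rpow_const.tendsto _).comp (trunc g hg))
      (.inl (by simp [hg0, h0, h0.le]))
  · refine prekopaLeindler_real_of_bounded h0 h1 (by fun_prop) (by fun_prop) hh (bdd f n)
      (bdd g n) fun x y => le_trans ?_ (H x y)
    gcongr
    all_goals exact min_le_left _ _

theorem PrekopaLeindler.prod {t : ℝ} {E F : Type*} [AddCommGroup E] [Module ℝ E] [MeasureSpace E]
    [AddCommGroup F] [Module ℝ F] [MeasureSpace F] [SFinite (volume : Measure E)]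
    [SFinite (volume : Measure F)] (hE : PrekopaLeindler t E) (hF : PrekopaLeindler t F) :
    PrekopaLeindler t (E × F) := by
  intro f g h hf hg hh H
  rw [Measure.volume_eq_prod, lintegral_prod _ hf.aemeasurable, lintegral_prod _ hg.aemeasurable,
    lintegral_prod _ hh.aemeasurable]
  refine hE _ _ _ hf.lintegral_prod_right' hg.lintegral_prod_right' hh.lintegral_prod_right'
    fun x₀ x₁ => ?_
  exact hF _ _ _ (by fun_prop) (by fun_prop) (by fun_prop) fun y₀ y₁ => H (x₀, y₀) (x₁, y₁)

theorem PrekopaLeindler.of_measurePreserving {t : ℝ} {E F : Type*} [AddCommGroup E] [Module ℝ E]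
    [MeasureSpace E] [AddCommGroup F] [Module ℝ F] [MeasureSpace F] (hE : PrekopaLeindler t E)
    (e : E → F) (he : MeasurePreserving e)
    (hl : ∀ x y, e ((1 - t) • x + t • y) = (1 - t) • e x + t • e y) : PrekopaLeindler t F := by
  intro f g h hf hg hh H
  rw [← he.lintegral_comp hf, ← he.lintegral_comp hg, ← he.lintegral_comp hh]
  refine hE _ _ _ (hf.comp he.measurable) (hg.comp he.measurable) (hh.comp he.measurable)
    fun x y => ?_
  rw [hl]
  exact H _ _

theorem prekopaLeindler_pi {t : ℝ} (h0 : 0 < t) (h1 : t < 1) (n : ℕ) :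
    PrekopaLeindler t (Fin n → ℝ) := by
  induction n with
  | zero =>
    intro f g h hf hg hh H
    rw [volume_pi, Measure.pi_of_empty, lintegral_dirac' _ hf, lintegral_dirac' _ hg,
      lintegral_dirac' _ hh]
    convert H _ _ using 2
  | succ n ih =>
    refine ((prekopaLeindler_real h0 h1).prod ih).of_measurePreserving _
      (volume_preserving_piFinSuccAbove (fun _ => ℝ) 0).symm fun x y => ?_
    ext i
    refine Fin.cases ?_ (fun j => ?_) i <;> simp [MeasurableEquiv.piFinSuccAbove]

/-- The Prékopa–Leindler inequality on Euclidean space. -/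
theorem prekopaLeindler_euclideanSpace {t : ℝ} (h0 : 0 < t) (h1 : t < 1) (n : ℕ) :
    PrekopaLeindler t (EuclideanSpace ℝ (Fin n)) :=
  (prekopaLeindler_pi h0 h1 n).of_measurePreserving _ (PiLp.volume_preserving_toLp (Fin n))
    fun _ _ => rfl

theorem PrekopaLeindler.setIntegral_exp {t : ℝ} (h0 : 0 < t) (h1 : t < 1) {E : Type*}
    [NormedAddCommGroup E] [NormedSpace ℝ E] [MeasureSpace E] [BorelSpace E]
    [IsFiniteMeasureOnCompacts (volume : Measure E)]
    (hE : PrekopaLeindler t E) {B : Set E} (hB : IsCompact B)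
    {p q r : E → ℝ} (hp : Continuous p) (hq : Continuous q) (hr : Continuous r)
    (h : ∀ x ∈ B, ∀ y ∈ B, (1 - t) • x + t • y ∈ B ∧
      r ((1 - t) • x + t • y) ≤ (1 - t) * p x + t * q y) :
    (∫ x in B, exp (-p x)) ^ (1 - t) * (∫ x in B, exp (-q x)) ^ t ≤ ∫ x in B, exp (-r x) := by
  have h1' : 0 < 1 - t := by linarith
  have hBm := hB.measurableSet
  have meas : ∀ u : E → ℝ, Continuous u →
      Measurable (B.indicator fun x => ENNReal.ofReal (exp (-u x))) := fun u hu =>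
    (by fun_prop : Measurable fun x => ENNReal.ofReal (exp (-u x))).indicator hBm
  have int : ∀ u : E → ℝ, Continuous u →
      ∫⁻ x, B.indicator (fun x => ENNReal.ofReal (exp (-u x))) x
        = ENNReal.ofReal (∫ x in B, exp (-u x)) := by
    intro u hu
    rw [lintegral_indicator hBm, ofReal_integral_eq_lintegral_ofReal
      ((by fun_prop : Continuous fun x => exp (-u x)).continuousOn.integrableOn_compact hB)
      (ae_of_all _ fun x => (exp_pos _).le)]
  have key := hE _ _ _ (meas p hp) (meas q hq) (meas r hr) fun x y => by
    by_cases hx : x ∈ B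
    · by_cases hy : y ∈ B
      · rw [Set.indicator_of_mem hx, Set.indicator_of_mem hy, Set.indicator_of_mem (h x hx y hy).1,
          ENNReal.ofReal_rpow_of_pos (exp_pos _), ENNReal.ofReal_rpow_of_pos (exp_pos _),
          ← ENNReal.ofReal_mul (by positivity), ← Real.exp_mul, ← Real.exp_mul, ← Real.exp_add]
        refine ENNReal.ofReal_le_ofReal (exp_le_exp.2 ?_)
        linarith [(h x hx y hy).2]
      · simp [hy, h0]
    · simp [hx, h1']
  rw [int p hp, int q hq, int r hr,
    ENNReal.ofReal_rpow_of_nonneg (integral_nonneg fun x => (exp_pos _).le) h1'.le,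
    ENNReal.ofReal_rpow_of_nonneg (integral_nonneg fun x => (exp_pos _).le) h0.le,
    ← ENNReal.ofReal_mul (Real.rpow_nonneg (integral_nonneg fun x => (exp_pos _).le) _)] at key
  exact (ENNReal.ofReal_le_ofReal_iff (integral_nonneg fun x => (exp_pos _).le)).1 key

theorem inner_gradient_eq_fderiv {E : Type*} [NormedAddCommGroup E] [InnerProductSpace ℝ E]
    [CompleteSpace E] (f : E → ℝ) (x v : E) : ⟪gradient f x, v⟫ = fderiv ℝ f x v := by
  simp [gradient]

theorem ContDiff.continuous_gradient {E : Type*} [NormedAddCommGroup E] [InnerProductSpace ℝ E]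
    [CompleteSpace E] {f : E → ℝ} (hf : ContDiff ℝ 1 f) : Continuous (gradient f) :=
  (InnerProductSpace.toDual ℝ E).symm.continuous.comp (hf.continuous_fderiv one_ne_zero)

/-- A `C¹` function on a compact convex set is approximated by its first-order expansions
uniformly in the base point. -/
theorem ContDiff.exists_forall_le_of_isCompact {E : Type*} [NormedAddCommGroup E]
    [InnerProductSpace ℝ E] [CompleteSpace E] {f : E → ℝ} (hf : ContDiff ℝ 1 f) {B : Set E}
    (hB : IsCompact B) (hBc : Convex ℝ B) {ε : ℝ} (hε : 0 < ε) :
    ∃ δ > 0, ∀ z ∈ B, ∀ x ∈ B, ‖x - z‖ < δ →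
      f z + ⟪gradient f z, x - z⟫ - ε * ‖x - z‖ ≤ f x := by
  obtain ⟨δ, hδ, h⟩ := Metric.uniformContinuousOn_iff.1
    (hB.uniformContinuousOn_of_continuous (hf.continuous_fderiv one_ne_zero).continuousOn) ε hε
  refine ⟨δ, hδ, fun z hz x hx hxz => ?_⟩
  have hseg : segment ℝ z x ⊆ B := hBc.segment_subset hz hx
  have key := (convex_segment z x).norm_image_sub_le_of_norm_hasFDerivWithin_le'
    (f := f) (f' := fderiv ℝ f) (φ := fderiv ℝ f z) (C := ε)
    (fun y _ => (hf.differentiable one_ne_zero y).hasFDerivAt.hasFDerivWithinAt) (fun y hy => ?_)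
    (left_mem_segment ℝ z x) (right_mem_segment ℝ z x)
  · rw [inner_gradient_eq_fderiv]
    linarith [neg_le_of_abs_le key]
  · rw [← dist_eq_norm]
    refine (h y (hseg hy) z hz ?_).le
    rw [dist_eq_norm]
    exact (norm_sub_le_of_mem_segment hy).trans_lt hxz

theorem mul_log_div_le_setIntegral {n : ℕ} {φ ψ c : EuclideanSpace ℝ (Fin n) → ℝ}
    (hφ : Continuous φ) (hψ : ContDiff ℝ 1 ψ) (hc : Continuous c)
    (hle : ∀ z y, ⟪gradient ψ z, y⟫ - φ y ≤ c z)
    {B : Set (EuclideanSpace ℝ (Fin n))} (hB : IsCompact B) (hBc : Convex ℝ B)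
    (hBi : (interior B).Nonempty) :
    (∫ x in B, exp (-ψ x)) * log ((∫ x in B, exp (-φ x)) / ∫ x in B, exp (-ψ x)) ≤
      ∫ z in B, (ψ z - ⟪gradient ψ z, z⟫ + c z) * exp (-ψ z) := by
  have hgrad := hψ.continuous_gradient
  have hψc := hψ.continuous
  have hpos : ∀ u : EuclideanSpace ℝ (Fin n) → ℝ, Continuous u → 0 < ∫ x in B, exp (-u x) := by
    intro u hu
    rw [setIntegral_pos_iff_support_of_nonneg_ae (ae_of_all _ fun x => (exp_pos _).le)
      ((by fun_prop : Continuous fun x => exp (-u x)).continuousOn.integrableOn_compact hB)]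
    have : Function.support (fun x => exp (-u x)) = Set.univ := by
      ext x; simp [(exp_pos _).ne']
    rw [this, Set.univ_inter]
    exact (isOpen_interior.measure_pos _ hBi).trans_le (measure_mono interior_subset)
  set Z := ∫ x in B, exp (-ψ x) with hZ
  set W := ∫ x in B, exp (-φ x) with hW
  have hZ0 : 0 < Z := hpos ψ hψc
  have hW0 : 0 < W := hpos φ hφ
  obtain ⟨D, hD0, hD⟩ : ∃ D > 0, ∀ x ∈ B, ∀ y ∈ B, ‖x - y‖ ≤ D := by
    obtain ⟨D, hD⟩ := Metric.isBounded_iff.1 hB.isBounded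
    exact ⟨max D 1, by positivity, fun x hx y hy => by
      rw [← dist_eq_norm]; exact (hD hx hy).trans (le_max_left _ _)⟩
  refine le_of_forall_pos_le_add fun η hη => ?_
  set ε := η / (2 * D * Z) with hε
  have hε0 : 0 < ε := by positivity
  set K : EuclideanSpace ℝ (Fin n) → ℝ := fun z => ψ z - ⟪gradient ψ z, z⟫ + c z + ε * D with hK
  have hKc : Continuous K := by fun_prop
  obtain ⟨M, hM0, hM⟩ : ∃ M > 0, ∀ z ∈ B, |K z| ≤ M := by
    obtain ⟨M, hM⟩ := hB.exists_bound_of_continuousOn hKc.continuousOn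
    exact ⟨max M 1, by positivity, fun z hz => (hM z hz).trans (le_max_left _ _)⟩
  obtain ⟨δ, hδ0, hδ⟩ := hψ.exists_forall_le_of_isCompact hB hBc hε0
  obtain ⟨t, ht0, ht1, htδ, htM, htη⟩ : ∃ t : ℝ, 0 < t ∧ t < 1 ∧ t * D < δ ∧ t * M ≤ 1 ∧
      t * M ^ 2 * Z ≤ η / 2 := by
    refine ⟨min (1 / 2) (min (δ / (2 * D)) (min (1 / M) (η / 2 / (M ^ 2 * Z)))), by positivity,
      ?_, ?_, ?_, ?_⟩
    · exact (min_le_left _ _).trans_lt (by norm_num)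
    · refine (mul_le_mul_of_nonneg_right ((min_le_right _ _).trans (min_le_left _ _))
        hD0.le).trans_lt ?_
      field_simp
      linarith
    · rw [← le_div_iff₀ hM0]
      exact (min_le_right _ _).trans ((min_le_right _ _).trans (min_le_left _ _))
    · rw [mul_assoc, ← le_div_iff₀ (by positivity)]
      exact (min_le_right _ _).trans ((min_le_right _ _).trans (min_le_right _ _))
  have hPL := (prekopaLeindler_euclideanSpace ht0 ht1 n).setIntegral_exp ht0 ht1 hB
    (p := ψ) (q := φ) (r := fun z => ψ z - t * K z) hψc hφ (by fun_prop) fun x hx y hy => by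
      have hz : (1 - t) • x + t • y ∈ B := hBc hx hy (by linarith) ht0.le (by ring)
      refine ⟨hz, ?_⟩
      set z := (1 - t) • x + t • y with hzdef
      have e1 : x - z = t • (x - y) := by rw [hzdef]; module
      have hn : ‖x - z‖ ≤ t * D := by
        rw [e1, norm_smul, Real.norm_of_nonneg ht0.le]
        exact mul_le_mul_of_nonneg_left (hD x hx y hy) ht0.le
      have h1 := hδ z hz x hx (hn.trans_lt htδ)
      have h2 := hle z y
      have e2 : (1 - t) * ⟪gradient ψ z, x - z⟫
          = t * (⟪gradient ψ z, z⟫ - ⟪gradient ψ z, y⟫) := by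
        rw [← inner_sub_right, ← real_inner_smul_right, ← real_inner_smul_right]
        congr 1
        rw [hzdef]; module
      have h3 : ε * ‖x - z‖ ≤ ε * (t * D) := mul_le_mul_of_nonneg_left hn hε0.le
      have h4 := mul_le_mul_of_nonneg_left h1 (by linarith : 0 ≤ 1 - t)
      have h5 := mul_le_mul_of_nonneg_left h2 ht0.le
      have h6 : 0 ≤ t * (ε * (t * D)) := by positivity
      have h7 := mul_le_mul_of_nonneg_left h3 (by linarith : 0 ≤ 1 - t)
      simp only [hK]
      linarith
  have hint : ∀ u : EuclideanSpace ℝ (Fin n) → ℝ, Continuous u → IntegrableOn u B := fun u hu =>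
    hu.continuousOn.integrableOn_compact hB
  have hupper : ∫ z in B, exp (-(ψ z - t * K z)) ≤
      Z + t * (∫ z in B, K z * exp (-ψ z)) + t ^ 2 * M ^ 2 * Z := by
    calc ∫ z in B, exp (-(ψ z - t * K z))
        ≤ ∫ z in B, (exp (-ψ z) + t * (K z * exp (-ψ z)) + t ^ 2 * M ^ 2 * exp (-ψ z)) := by
          refine setIntegral_mono_on (hint _ (by fun_prop)) (hint _ (by fun_prop))
            hB.measurableSet fun z hz => ?_
          have hb : |t * K z| ≤ t * M := by
            rw [abs_mul, abs_of_pos ht0]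
            exact mul_le_mul_of_nonneg_left (hM z hz) ht0.le
          have h1 := (abs_le.1 (Real.abs_exp_sub_one_sub_id_le (hb.trans htM))).2
          have h2 : (t * K z) ^ 2 ≤ t ^ 2 * M ^ 2 := by
            rw [← mul_pow]; exact sq_le_sq' (neg_le_of_abs_le hb) (le_of_abs_le hb)
          rw [show -(ψ z - t * K z) = t * K z + -ψ z by ring, Real.exp_add]
          nlinarith [exp_pos (-ψ z)]
      _ = _ := by
          rw [integral_add
              (hint (fun z => exp (-ψ z) + t * (K z * exp (-ψ z))) (by fun_prop))
              (hint _ (by fun_prop)),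
            integral_add (hint _ (by fun_prop)) (hint _ (by fun_prop)), integral_const_mul,
            integral_const_mul]
  have hlower : Z + t * (Z * log (W / Z)) ≤ Z ^ (1 - t) * W ^ t := by
    have : Z ^ (1 - t) * W ^ t = Z * exp (t * log (W / Z)) := by
      rw [show Z * exp (t * log (W / Z)) = exp (log Z + t * log (W / Z)) by
          rw [Real.exp_add, Real.exp_log hZ0],
        Real.rpow_def_of_pos hZ0, Real.rpow_def_of_pos hW0, Real.log_div hW0.ne' hZ0.ne',
        ← Real.exp_add]
      congr 1; ring
    rw [this]
    nlinarith [Real.add_one_le_exp (t * log (W / Z))]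
  have hKint : ∫ z in B, K z * exp (-ψ z) =
      (∫ z in B, (ψ z - ⟪gradient ψ z, z⟫ + c z) * exp (-ψ z)) + ε * D * Z := by
    rw [hZ, ← integral_const_mul, ← integral_add (hint _ (by fun_prop)) (hint _ (by fun_prop))]
    refine integral_congr_ae (ae_of_all _ fun z => ?_)
    simp only [hK]; ring
  have hεη : ε * D * Z = η / 2 := by rw [hε]; field_simp
  rw [hεη] at hKint
  have hfin : t * (Z * log (W / Z)) ≤ t * ((∫ z in B, K z * exp (-ψ z)) + t * M ^ 2 * Z) := by
    linarith [hlower.trans (hPL.trans hupper)]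
  have := le_of_mul_le_mul_left hfin ht0
  linarith

theorem ConvexOn.add_inner_gradient_le {E : Type*} [NormedAddCommGroup E] [InnerProductSpace ℝ E]
    [CompleteSpace E] {f : E → ℝ} (hf : ConvexOn ℝ Set.univ f) {x : E}
    (hd : DifferentiableAt ℝ f x) (y : E) : f x + ⟪gradient f x, y - x⟫ ≤ f y := by
  rw [inner_gradient_eq_fderiv]
  have hderiv : HasDerivAt (fun s : ℝ => f (x + s • (y - x))) (fderiv ℝ f x (y - x)) 0 :=
    hd.hasFDerivAt.hasLineDerivAt (y - x)
  have hlim := (hasDerivAt_iff_tendsto_slope.1 hderiv).mono_left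
    (nhdsWithin_mono 0 fun s (hs : s ∈ Set.Ioi (0 : ℝ)) => ne_of_gt hs)
  have : fderiv ℝ f x (y - x) ≤ f y - f x := by
    refine le_of_tendsto hlim ?_
    filter_upwards [Ioo_mem_nhdsGT (zero_lt_one (α := ℝ))] with s hs
    have h := hf.2 (Set.mem_univ x) (Set.mem_univ y) (by linarith [hs.2] : 0 ≤ 1 - s) hs.1.le
      (by ring)
    rw [show (1 - s) • x + s • y = x + s • (y - x) by module] at h
    simp only [slope_def_field, zero_smul, add_zero, sub_zero]
    rw [div_le_iff₀ hs.1]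
    simp only [smul_eq_mul] at h
    linarith
  linarith

theorem legendre_gradient {n : ℕ} {φ : EuclideanSpace ℝ (Fin n) → ℝ}
    (hconv : ConvexOn ℝ Set.univ φ) {x : EuclideanSpace ℝ (Fin n)} (hd : DifferentiableAt ℝ φ x) :
    legendre φ (gradient φ x) = ⟪gradient φ x, x⟫ - φ x := by
  have h : ∀ z, ⟪gradient φ x, z⟫ - φ z ≤ ⟪gradient φ x, x⟫ - φ x := fun z => by
    have := hconv.add_inner_gradient_le hd z
    rw [inner_sub_right] at this
    linarith
  refine le_antisymm (ciSup_le h) (le_ciSup (f := fun z => ⟪gradient φ x, z⟫ - φ z)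
    ⟨⟪gradient φ x, x⟫ - φ x, ?_⟩ x)
  rintro _ ⟨z, rfl⟩
  exact h z

/-- The modified logarithmic Sobolev inequality for `exp (-φ)`, stated with respect to Lebesgue
measure. -/
theorem integral_mul_exp_sub_mul_log_le {n : ℕ} {φ g : EuclideanSpace ℝ (Fin n) → ℝ}
    (hφ : ContDiff ℝ 1 φ) (hconv : ConvexOn ℝ Set.univ φ)
    (hcoer : Tendsto (fun x => φ x / ‖x‖) (cobounded (EuclideanSpace ℝ (Fin n))) atTop)
    (hnorm : ∫ x, exp (-φ x) = 1) (hg : ContDiff ℝ 1 g)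
    (hint1 : Integrable fun x => exp (-φ x) * exp (g x))
    (hint2 : Integrable fun x => exp (-φ x) * (g x * exp (g x)))
    (hint3 : Integrable fun x => exp (-φ x) * ((⟪x, gradient g x⟫ - legendre φ (gradient φ x)
        + legendre φ (gradient φ x - gradient g x)) * exp (g x))) :
    (∫ x, exp (-φ x) * (g x * exp (g x)))
        - (∫ x, exp (-φ x) * exp (g x)) * log (∫ x, exp (-φ x) * exp (g x)) ≤
      ∫ x, exp (-φ x) * ((⟪x, gradient g x⟫ - legendre φ (gradient φ x)
        + legendre φ (gradient φ x - gradient g x)) * exp (g x)) := by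
  have hφi : Integrable fun x => exp (-φ x) := by
    by_contra h
    simp [integral_undef h] at hnorm
  have hψ : ContDiff ℝ 1 fun x => φ x - g x := hφ.sub hg
  have hgrad : ∀ x, gradient (fun x => φ x - g x) x = gradient φ x - gradient g x := fun x => by
    simp only [gradient]
    rw [fderiv_fun_sub (hφ.differentiable one_ne_zero x) (hg.differentiable one_ne_zero x), map_sub]
  have hexp : ∀ x, exp (-(φ x - g x)) = exp (-φ x) * exp (g x) := fun x => by
    rw [← Real.exp_add]; congr 1; ring
  set m := ∫ x, exp (-φ x) * exp (g x) with hm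
  have hm0 : 0 < m := by
    simp only [hm, ← hexp] at hint1 ⊢
    exact integral_exp_pos hint1
  set J := fun x => exp (-φ x) * ((⟪x, gradient g x⟫ - legendre φ (gradient φ x)
        + legendre φ (gradient φ x - gradient g x)) * exp (g x)) with hJ
  have hlocal : ∀ k : ℕ,
      (∫ x in Metric.closedBall 0 (k + 1 : ℝ), exp (-φ x) * exp (g x)) *
        log ((∫ x in Metric.closedBall 0 (k + 1 : ℝ), exp (-φ x)) /
          ∫ x in Metric.closedBall 0 (k + 1 : ℝ), exp (-φ x) * exp (g x)) ≤
      ∫ x in Metric.closedBall 0 (k + 1 : ℝ), (J x - exp (-φ x) * (g x * exp (g x))) := by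
    intro k
    have h := mul_log_div_le_setIntegral (φ := φ) (ψ := fun x => φ x - g x)
      (c := fun x => legendre φ (gradient φ x - gradient g x)) hφ.continuous hψ
      ((continuous_legendre hφ.continuous hcoer).comp
        (hφ.continuous_gradient.sub hg.continuous_gradient))
      (fun z y => by rw [hgrad]; exact inner_sub_le_legendre hφ.continuous hcoer _ _)
      (isCompact_closedBall 0 (k + 1 : ℝ)) (convex_closedBall _ _)
      ⟨0, Metric.ball_subset_interior_closedBall (Metric.mem_ball_self (by positivity))⟩
    simp only [hexp] at h
    refine h.trans_eq (integral_congr_ae (ae_of_all _ fun x => ?_))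
    simp only [hJ]
    rw [hgrad, legendre_gradient hconv (hφ.differentiable one_ne_zero x), inner_sub_left,
      real_inner_comm x (gradient g x)]
    ring
  have hlim : ∀ u : EuclideanSpace ℝ (Fin n) → ℝ, Integrable u →
      Tendsto (fun k : ℕ => ∫ x in Metric.closedBall 0 (k + 1 : ℝ), u x) atTop
        (nhds (∫ x, u x)) := by
    intro u hu
    have hun : ⋃ k : ℕ, Metric.closedBall (0 : EuclideanSpace ℝ (Fin n)) (k + 1 : ℝ) = Set.univ := by
      refine Set.eq_univ_of_forall fun x => Set.mem_iUnion.2 ?_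
      obtain ⟨k, hk⟩ := exists_nat_ge ‖x‖
      exact ⟨k, by simp; linarith⟩
    have := tendsto_setIntegral_of_monotone (μ := volume) (f := u)
      (s := fun k : ℕ => Metric.closedBall (0 : EuclideanSpace ℝ (Fin n)) (k + 1 : ℝ))
      (fun k => Metric.isClosed_closedBall.measurableSet)
      (fun i j hij => Metric.closedBall_subset_closedBall (by
        have : (i : ℝ) ≤ j := by exact_mod_cast hij
        linarith)) hu.integrableOn
    rwa [hun, setIntegral_univ] at this
  have hL := hlim _ hint1
  have hlimL := hL.mul (((hlim _ hφi).div hL hm0.ne').log (by rw [hnorm]; positivity))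
  have := le_of_tendsto_of_tendsto' hlimL (hlim _ (hint3.sub hint2)) hlocal
  rw [integral_sub' hint3 hint2, hnorm, ← hm, one_div, Real.log_inv] at this
  linarith

/-- The entropy is monotone in the measure, up to the domination constant. -/
theorem integral_mul_exp_sub_mul_log_le_of_le_smul {α : Type*} [MeasurableSpace α]
    {μ ν : Measure α} [IsProbabilityMeasure μ] [IsProbabilityMeasure ν] {C : ℝ} (hC : 0 ≤ C)
    (hμν : μ ≤ ENNReal.ofReal C • ν) {g : α → ℝ}
    (hμ : Integrable (fun x => exp (g x)) μ) (hν : Integrable (fun x => exp (g x)) ν)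
    (hμ' : Integrable (fun x => g x * exp (g x)) μ)
    (hν' : Integrable (fun x => g x * exp (g x)) ν) :
    (∫ x, g x * exp (g x) ∂μ) - (∫ x, exp (g x) ∂μ) * log (∫ x, exp (g x) ∂μ) ≤
      C * ((∫ x, g x * exp (g x) ∂ν) - (∫ x, exp (g x) ∂ν) * log (∫ x, exp (g x) ∂ν)) := by
  set a := ∫ x, exp (g x) ∂μ with ha
  set b := ∫ x, exp (g x) ∂ν with hb
  have ha0 : 0 < a := integral_exp_pos hμ
  have hb0 : 0 < b := integral_exp_pos hν
  have key : ∀ u > 0, 0 ≤ u * log u - u * log b - u + b := fun u hu => by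
    have h := Real.log_le_sub_one_of_pos (div_pos hb0 hu)
    rw [Real.log_div hb0.ne' hu.ne'] at h
    have h2 := mul_le_mul_of_nonneg_left h hu.le
    have h3 : u * (b / u - 1) = b - u := by field_simp
    linarith
  have hint : ∀ (ρ : Measure α) [IsProbabilityMeasure ρ], Integrable (fun x => exp (g x)) ρ →
      Integrable (fun x => g x * exp (g x)) ρ →
      Integrable (fun x => g x * exp (g x) - exp (g x) * log b - exp (g x) + b) ρ ∧
      ∫ x, (g x * exp (g x) - exp (g x) * log b - exp (g x) + b) ∂ρ =
        (∫ x, g x * exp (g x) ∂ρ) - (∫ x, exp (g x) ∂ρ) * log b - (∫ x, exp (g x) ∂ρ) + b := by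
    intro ρ _ h1 h2
    have i1 := h2.sub (h1.mul_const (log b))
    have i2 := i1.sub h1
    refine ⟨i2.add (integrable_const b), ?_⟩
    rw [integral_add (by exact i2) (integrable_const b), integral_sub (by exact i1) h1,
      integral_sub h2 (h1.mul_const _), integral_mul_const]
    simp
  have hmono := integral_mono_measure hμν (ae_of_all _ fun x => by
    have := key _ (exp_pos (g x))
    rw [Real.log_exp, mul_comm (exp (g x)) (g x)] at this
    exact this) ((hint ν hν hν').1.smul_measure ENNReal.ofReal_ne_top)
  rw [integral_smul_measure, (hint μ hμ hμ').2, (hint ν hν hν').2, ENNReal.toReal_ofReal hC,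
    smul_eq_mul, ← ha, ← hb] at hmono
  have := key a ha0
  linarith

theorem perturbed_log_sobolev (n : ℕ) (φ : EuclideanSpace ℝ (Fin n) → ℝ)
    (hφ : ContDiff ℝ 1 φ) (hconv : StrictConvexOn ℝ Set.univ φ)
    (hcoer : Tendsto (fun x => φ x / ‖x‖) (cobounded (EuclideanSpace ℝ (Fin n))) atTop)
    (hnorm : ∫ x, Real.exp (-φ x) = 1)
    (U : EuclideanSpace ℝ (Fin n) → ℝ)
    (hUa : BddAbove (Set.range U)) (hUb : BddBelow (Set.range U))
    (Z : ℝ) (hZ : Z = ∫ x, Real.exp (-(φ x + U x)))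
    (μ : Measure (EuclideanSpace ℝ (Fin n)))
    (hμ : μ = volume.withDensity fun x => ENNReal.ofReal (Real.exp (-(φ x + U x)) / Z))
    (g : EuclideanSpace ℝ (Fin n) → ℝ) (hg : ContDiff ℝ 1 g)
    (hint1 : Integrable (fun x => Real.exp (g x)) μ)
    (hint2 : Integrable (fun x =>
      Real.exp (g x) * Real.log (Real.exp (g x) / ∫ y, Real.exp (g y) ∂μ)) μ)
    (hint3 : Integrable (fun x =>
      (⟪x, gradient g x⟫ - legendre φ (gradient φ x)
        + legendre φ (gradient φ x - gradient g x)) * Real.exp (g x)) μ) :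
    Ent μ (fun x => Real.exp (g x)) ≤
      Real.exp (2 * (sSup (Set.range U) - sInf (Set.range U))) *
      ∫ x, (⟪x, gradient g x⟫ - legendre φ (gradient φ x)
        + legendre φ (gradient φ x - gradient g x)) * Real.exp (g x) ∂μ := by
  have hint_zero : Ent (0 : Measure (EuclideanSpace ℝ (Fin n))) (fun x => exp (g x)) = 0 := by
    simp [Ent]
  by_cases hΦi : Integrable fun x => exp (-(φ x + U x))
  swap
  · have hμ0 : μ = 0 := by
      rw [hμ, hZ, integral_undef hΦi]
      simp
    rw [hμ0, hint_zero]
    simp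
  have hφi : Integrable fun x => exp (-φ x) := by
    by_contra h
    simp [integral_undef h] at hnorm
  set M := sSup (Set.range U)
  set m := sInf (Set.range U)
  have hUM : ∀ x, U x ≤ M := fun x => le_csSup hUa ⟨x, rfl⟩
  have hUm : ∀ x, m ≤ U x := fun x => csInf_le hUb ⟨x, rfl⟩
  have hZle : Z ≤ exp (-m) := by
    calc Z ≤ ∫ x, exp (-m) * exp (-φ x) := by
          rw [hZ]
          refine integral_mono hΦi (hφi.const_mul _) fun x => ?_
          simp only [← Real.exp_add]
          exact exp_le_exp.2 (by linarith [hUm x])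
      _ = exp (-m) := by rw [integral_const_mul, hnorm, mul_one]
  have hleZ : exp (-M) ≤ Z := by
    calc exp (-M) = ∫ x, exp (-M) * exp (-φ x) := by rw [integral_const_mul, hnorm, mul_one]
      _ ≤ Z := by
          rw [hZ]
          refine integral_mono (hφi.const_mul _) hΦi fun x => ?_
          simp only [← Real.exp_add]
          exact exp_le_exp.2 (by linarith [hUM x])
  have hZ0 : 0 < Z := (exp_pos _).trans_le hleZ
  set C := exp (M - m) with hC
  have hC0 : 0 < C := exp_pos _
  set ν : Measure (EuclideanSpace ℝ (Fin n)) :=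
    volume.withDensity fun x => ENNReal.ofReal (exp (-φ x)) with hν
  have hφm : Measurable fun x => ENNReal.ofReal (exp (-φ x)) := by
    have := hφ.continuous
    fun_prop
  have hμν : μ ≤ ENNReal.ofReal C • ν := by
    rw [hμ, hν, ← withDensity_smul' _ _ ENNReal.ofReal_ne_top]
    refine withDensity_mono (ae_of_all _ fun x => ?_)
    simp only [Pi.smul_apply, smul_eq_mul]
    rw [← ENNReal.ofReal_mul hC0.le]
    refine ENNReal.ofReal_le_ofReal ((div_le_iff₀ hZ0).2 ?_)
    calc exp (-(φ x + U x)) ≤ C * exp (-φ x) * exp (-M) := by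
          rw [hC, ← Real.exp_add, ← Real.exp_add]
          exact exp_le_exp.2 (by linarith [hUm x])
      _ ≤ C * exp (-φ x) * Z := by gcongr
  have hνμ : ν ≤ ENNReal.ofReal C • μ := by
    rw [hμ, hν, ← withDensity_smul' _ _ ENNReal.ofReal_ne_top]
    refine withDensity_mono (ae_of_all _ fun x => ?_)
    simp only [Pi.smul_apply, smul_eq_mul]
    rw [← ENNReal.ofReal_mul hC0.le, ← mul_div_assoc]
    refine ENNReal.ofReal_le_ofReal ((le_div_iff₀ hZ0).2 ?_)
    calc exp (-φ x) * Z ≤ exp (-φ x) * exp (-m) := by gcongr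
      _ ≤ C * exp (-(φ x + U x)) := by
          rw [hC, ← Real.exp_add, ← Real.exp_add]
          exact exp_le_exp.2 (by linarith [hUM x])
  have : IsProbabilityMeasure ν := ⟨by
    rw [hν, withDensity_apply _ MeasurableSet.univ, Measure.restrict_univ,
      ← ofReal_integral_eq_lintegral_ofReal hφi (ae_of_all _ fun x => (exp_pos _).le), hnorm,
      ENNReal.ofReal_one]⟩
  have : IsProbabilityMeasure μ := ⟨by
    rw [hμ, withDensity_apply _ MeasurableSet.univ, Measure.restrict_univ,
      ← ofReal_integral_eq_lintegral_ofReal (hΦi.div_const Z)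
        (ae_of_all _ fun x => div_nonneg (exp_pos _).le hZ0.le), integral_div, ← hZ,
      div_self hZ0.ne', ENNReal.ofReal_one]⟩
  have hνint : ∀ u : EuclideanSpace ℝ (Fin n) → ℝ, Integrable u μ → Integrable u ν :=
    fun u hu => (hu.smul_measure ENNReal.ofReal_ne_top).mono_measure hνμ
  have hνvol : ∀ u : EuclideanSpace ℝ (Fin n) → ℝ, Integrable u μ →
      Integrable fun x => exp (-φ x) * u x := fun u hu => by
    have := (integrable_withDensity_iff_integrable_smul' hφm
      (ae_of_all _ fun x => ENNReal.ofReal_lt_top)).1 (hνint u hu)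
    simpa [ENNReal.toReal_ofReal (exp_pos _).le] using this
  have hνeq : ∀ u : EuclideanSpace ℝ (Fin n) → ℝ, ∫ x, u x ∂ν = ∫ x, exp (-φ x) * u x :=
    fun u => by
      rw [hν, integral_withDensity_eq_integral_toReal_smul hφm
        (ae_of_all _ fun x => ENNReal.ofReal_lt_top)]
      simp [ENNReal.toReal_ofReal (exp_pos _).le]
  have hpos : 0 < ∫ x, exp (g x) ∂μ := integral_exp_pos hint1
  have hlog : ∀ x, exp (g x) * log (exp (g x) / ∫ y, exp (g y) ∂μ)
      = g x * exp (g x) - exp (g x) * log (∫ y, exp (g y) ∂μ) := fun x => by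
    rw [Real.log_div (exp_pos _).ne' hpos.ne', Real.log_exp]
    ring
  have hint : Integrable (fun x => g x * exp (g x)) μ := by
    refine (hint2.add (hint1.mul_const (log (∫ y, exp (g y) ∂μ)))).congr (ae_of_all _ fun x => ?_)
    simp only [Pi.add_apply, hlog]
    ring
  have hEnt : Ent μ (fun x => exp (g x)) =
      (∫ x, g x * exp (g x) ∂μ) - (∫ x, exp (g x) ∂μ) * log (∫ x, exp (g x) ∂μ) := by
    simp only [Ent, hlog]
    rw [integral_sub hint (hint1.mul_const _), integral_mul_const]
  have hsob := integral_mul_exp_sub_mul_log_le hφ hconv.convexOn hcoer hnorm hg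
    (hνvol _ hint1) (hνvol _ hint) (hνvol _ hint3)
  simp only [← hνeq] at hsob
  have hcost : ∀ x, 0 ≤ (⟪x, gradient g x⟫ - legendre φ (gradient φ x)
      + legendre φ (gradient φ x - gradient g x)) * exp (g x) := fun x => by
    have h := inner_sub_le_legendre hφ.continuous hcoer (gradient φ x - gradient g x) x
    rw [inner_sub_left, real_inner_comm x (gradient g x)] at h
    refine mul_nonneg ?_ (exp_pos _).le
    rw [legendre_gradient hconv.convexOn (hφ.differentiable one_ne_zero x)]
    linarith
  have hmono := integral_mono_measure hνμ (ae_of_all _ hcost)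
    (hint3.smul_measure ENNReal.ofReal_ne_top)
  rw [integral_smul_measure, ENNReal.toReal_ofReal hC0.le, smul_eq_mul] at hmono
  rw [hEnt]
  calc _ ≤ _ := integral_mul_exp_sub_mul_log_le_of_le_smul hC0.le hμν hint1 (hνint _ hint1) hint
          (hνint _ hint)
    _ ≤ C * (C * _) := mul_le_mul_of_nonneg_left (hsob.trans hmono) hC0.le
    _ = _ := by rw [← mul_assoc, hC, ← Real.exp_add]; congr 2; ring
end
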